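/- Calibration of the hydraulic micro-conductivity in three dimensions: fix δ > 0 and let k = k_r k_w / μ > 0 be the classical (relative-permeability-scaled) hydraulic mobility. For a constant K_p ∈ ℝ, the peridynamic fluid dissipation under a linear pressure field of gradient magnitude C₂, namely (1/2) ∫_{‖ζ‖ ≤ δ} (1/2) K_p C₂² ‖ζ‖ dζ = (π K_p δ⁴ / 4) C₂², equals the classical dissipation (3/2) k C₂² for every C₂ ∈ ℝ if and only if K_p = 6 k / (π δ⁴). -/

import Mathlib

open MeasureTheory

/-- The integral of the norm over a ball of radius `δ` in three-dimensional Euclidean space. -/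
theorem setIntegral_norm_closedBall_fin_three {δ : ℝ} (hδ : 0 ≤ δ) :
    ∫ ζ in Metric.closedBall (0 : EuclideanSpace ℝ (Fin 3)) δ, ‖ζ‖ = Real.pi * δ ^ 4 := by
  have hind (ζ : EuclideanSpace ℝ (Fin 3)) :
      (Metric.closedBall 0 δ).indicator (fun ζ ↦ ‖ζ‖) ζ =
        (Set.Iic δ).indicator (fun r : ℝ ↦ r) ‖ζ‖ := by
    simp [Set.indicator]
  have hradial : ∫ r in Set.Ioi (0 : ℝ), r ^ 2 • (Set.Iic δ).indicator (fun r : ℝ ↦ r) r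
      = δ ^ 4 / 4 := by
    have hpow (r : ℝ) : r ^ 2 • (Set.Iic δ).indicator (fun r : ℝ ↦ r) r =
        (Set.Iic δ).indicator (fun r : ℝ ↦ r ^ 3) r := by
      by_cases h : r ≤ δ <;> simp [h, pow_succ]
    simp_rw [hpow]
    rw [setIntegral_indicator measurableSet_Iic, Set.Ioi_inter_Iic,
      ← intervalIntegral.integral_of_le hδ, integral_pow]
    norm_num
  have hvol : volume.real (Metric.ball (0 : EuclideanSpace ℝ (Fin 3)) 1) = 4 / 3 * Real.pi := by
    rw [Measure.real, EuclideanSpace.volume_ball_fin_three]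
    rw [ENNReal.ofReal_one, one_pow, one_mul, ENNReal.toReal_ofReal (by positivity)]
    ring
  rw [← integral_indicator measurableSet_closedBall]
  simp_rw [hind]
  rw [integral_fun_norm_addHaar, finrank_euclideanSpace_fin, hradial, hvol]
  simp only [nsmul_eq_mul, smul_eq_mul]
  push_cast
  ring

/-- Calibration of the hydraulic micro-conductivity in three dimensions: the
peridynamic fluid dissipation `(1/2) ∫_{‖ζ‖≤δ} (1/2) K_p C₂² ‖ζ‖ dζ` equals
`(π K_p δ⁴ / 4) C₂²`, and it equals the classical dissipation `(3/2) k C₂²`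
for every `C₂` if and only if `K_p = 6 k / (π δ⁴)`. -/
theorem hydraulic_micro_conductivity_calibration
    (δ : ℝ) (hδ : 0 < δ) (k : ℝ) (hk : 0 < k) (Kp : ℝ) :
    (∀ c₂ : ℝ,
      (1 / 2) * ∫ ζ in Metric.closedBall (0 : EuclideanSpace ℝ (Fin 3)) δ,
          (1 / 2) * Kp * c₂ ^ 2 * ‖ζ‖
        = (Real.pi * Kp * δ ^ 4 / 4) * c₂ ^ 2) ∧
    ((∀ c₂ : ℝ,
      (1 / 2) * ∫ ζ in Metric.closedBall (0 : EuclideanSpace ℝ (Fin 3)) δ,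
          (1 / 2) * Kp * c₂ ^ 2 * ‖ζ‖
        = (3 / 2) * k * c₂ ^ 2) ↔ Kp = 6 * k / (Real.pi * δ ^ 4)) := by
  have hint (c₂ : ℝ) :
      (1 / 2) * ∫ ζ in Metric.closedBall (0 : EuclideanSpace ℝ (Fin 3)) δ,
          (1 / 2) * Kp * c₂ ^ 2 * ‖ζ‖
        = (Real.pi * Kp * δ ^ 4 / 4) * c₂ ^ 2 := by
    rw [integral_const_mul, setIntegral_norm_closedBall_fin_three hδ.le]
    ring
  refine ⟨hint, ?_⟩
  simp_rw [hint]
  rw [eq_div_iff (by positivity)]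
  constructor
  · intro h
    linear_combination 4 * h 1
  · intro h c₂
    linear_combination c₂ ^ 2 / 4 * h
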